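/- Let ι be a finite index type, let S = ι → Bool be the Boolean cube, and let (A, U) be a decision problem on S. Let r be the number of relevant coordinates and let m be the number of distinct optimizer sets (the cardinality of the range of the optimizer map). Then m ≤ 2^r. -/

import Mathlib

/-- The optimizer map of a decision problem with utility `U`. -/
def Opt {A S : Type*} (U : A → S → ℝ) (s : S) : Set A :=
  {a | ∀ b, U b s ≤ U a s}

/-- A coordinate set `I` is sufficient if agreement on `I` forces equal optimizer sets. -/
def Sufficient {ι : Type*} {X : ι → Type*} {A : Type*}
    (U : A → (∀ i, X i) → ℝ) (I : Set ι) : Prop :=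
  ∀ s s' : ∀ i, X i, (∀ i ∈ I, s i = s' i) → Opt U s = Opt U s'

/-- A coordinate `i` is relevant if erasing it destroys sufficiency. -/
def Relevant {ι : Type*} {X : ι → Type*} {A : Type*}
    (U : A → (∀ i, X i) → ℝ) (i : ι) : Prop :=
  ¬ Sufficient U (Set.univ \ {i})

theorem Sufficient.inter {ι : Type*} {X : ι → Type*} {A : Type*}
    {U : A → (∀ i, X i) → ℝ} {I J : Set ι} (hI : Sufficient U I) (hJ : Sufficient U J) :
    Sufficient U (I ∩ J) := by
  classical
  intro s s' h
  refine (hI s (fun i => if i ∈ I then s i else s' i) ?_).trans (hJ _ s' ?_)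
  · intro i hi
    simp [hi]
  · intro j hj
    by_cases hjI : j ∈ I
    · simpa [hjI] using h j ⟨hjI, hj⟩
    · simp [hjI]

/-- With finitely many coordinates, the relevant ones form a sufficient set. -/
theorem sufficient_setOf_relevant {ι : Type*} [Finite ι] {X : ι → Type*} {A : Type*}
    (U : A → (∀ i, X i) → ℝ) : Sufficient U {i | Relevant U i} := by
  have key (T : Set ι) (hT : ∀ i ∈ T, ¬ Relevant U i) : Sufficient U (Set.univ \ T) := by
    induction T, T.toFinite using Set.Finite.induction_on with
    | empty =>
      intro s s' h
      rw [funext fun i => h i (by simp)]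
    | @insert a T _ _ ih =>
      rw [← Set.union_singleton, ← Set.sdiff_inter_sdiff]
      exact (ih fun i hi => hT i (Set.mem_insert_of_mem a hi)).inter
        (not_not.mp (hT a (Set.mem_insert a T)))
  convert key {i | ¬ Relevant U i} fun _ hi => hi using 1
  ext i
  simp

/-- A sufficient set of `k` Boolean coordinates leaves at most `2 ^ k` optimizer sets. -/
theorem Sufficient.ncard_range_opt_le {ι : Type*} [Finite ι] {A : Type*}
    {U : A → (ι → Bool) → ℝ} {I : Set ι} (hI : Sufficient U I) :
    (Set.range (Opt U)).ncard ≤ 2 ^ I.ncard := by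
  classical
  let f : (I → Bool) → Set A := fun x => Opt U fun i => if h : i ∈ I then x ⟨i, h⟩ else false
  have hsub : Set.range (Opt U) ⊆ Set.range f := by
    rintro _ ⟨s, rfl⟩
    refine ⟨fun i => s i, hI _ _ fun i hi => ?_⟩
    simp [hi]
  calc (Set.range (Opt U)).ncard ≤ (Set.range f).ncard :=
        Set.ncard_le_ncard hsub (Set.finite_range f)
    _ ≤ Nat.card (I → Bool) := Finite.card_range_le f
    _ = 2 ^ I.ncard := by simp [Nat.card_fun, Set.ncard]

/-- On the Boolean cube, the number of optimizer-quotient classes is at most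
2 to the number of relevant coordinates. -/
theorem quotient_size_le_two_pow_srank {ι : Type*} [Fintype ι] {A : Type*}
    (U : A → (ι → Bool) → ℝ) :
    (Set.range (Opt U)).ncard ≤ 2 ^ ({i : ι | Relevant U i}.ncard) :=
  (sufficient_setOf_relevant U).ncard_range_opt_le
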